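/- arXiv:2311.00649 — 3 statements merged into one kernel-verified Lean document; each statement's English description precedes it below -/
import Mathlib

section
/- Let A be a finite discrete alphabet, let w ∈ A^ℤ be a balanced almost periodic word for the ℤ-shift, let ŵ ∈ A^{D∞} be its amplified word, and assume the orbit closure O(ŵ) ⊆ A^{D∞} under the D∞-shift is infinite. Then the subshift D∞ ↷ O(ŵ) is minimal and topologically free but not free, and it is almost finite. -/
open scoped Pointwise
open MeasureTheory

namespace Paper

section Basic

variable (G : Type*) [Group G] (X : Type*) [TopologicalSpace X] [MulAction G X]

/-- The action is minimal: every orbit is dense. -/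
def Minimal : Prop := ∀ x : X, Dense (MulAction.orbit G x)

/-- The action is topologically free: every nontrivial fixed-point set is nowhere dense. -/
def TopFree : Prop := ∀ g : G, g ≠ 1 → interior (closure {x : X | g • x = x}) = (∅ : Set X)

variable [MeasurableSpace X]

/-- `μ` is a `G`-invariant Borel probability measure. -/
def InvProb (μ : Measure X) : Prop :=
  IsProbabilityMeasure μ ∧ ∀ g : G, Measure.map (fun x : X => g • x) μ = μ

/-- The action is essentially free. -/
def EssFree : Prop :=
  ∀ g : G, g ≠ 1 → ∀ μ : Measure X, InvProb G X μ → μ {x : X | g • x = x} = 0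

/-- The small boundary property. -/
def SBP : Prop :=
  ∀ (x : X) (U : Set X), IsOpen U → x ∈ U →
    ∃ V : Set X, IsOpen V ∧ x ∈ V ∧ V ⊆ U ∧
      ∀ μ : Measure X, InvProb G X μ → μ (frontier V) = 0

end Basic

/-- `S` is a `(K, ε)`-Følner set: `|KS \ S| < ε |S|`. -/
def IsFolner {G : Type*} [Group G] (K S : Finset G) (ε : ℝ) : Prop :=
  letI := Classical.decEq G
  (((K * S) \ S).card : ℝ) < ε * S.card

/-- Amenability in the Følner sense. -/
def FolnerAmenable (G : Type*) [Group G] : Prop :=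
  ∀ (K : Finset G) (ε : ℝ), 0 < ε → ∃ S : Finset G, IsFolner K S ε

/-- A finite family of towers forming a castle: all levels are pairwise disjoint. -/
def IsCastle (G : Type*) [Group G] (X : Type*) [MulAction G X] {n : ℕ}
    (S : Fin n → Finset G) (B : Fin n → Set X) : Prop :=
  ∀ (i j : Fin n), ∀ s ∈ S i, ∀ t ∈ S j, (i, s) ≠ (j, t) → Disjoint (s • B i) (t • B j)

/-- The union of all levels of a castle. -/
def CastleUnion (G : Type*) [Group G] (X : Type*) [MulAction G X] {n : ℕ}
    (S : Fin n → Finset G) (B : Fin n → Set X) : Set X :=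
  ⋃ i, ⋃ s ∈ S i, s • B i

/-- `C ≺ O` : dynamical subordination of a (closed) set `C` to `O`. -/
def Subord (G : Type*) [Group G] (X : Type*) [TopologicalSpace X] [MulAction G X]
    (C O : Set X) : Prop :=
  ∃ (n : ℕ) (V : Fin n → Set X) (g : Fin n → G),
    (∀ k, IsOpen (V k)) ∧ (C ⊆ ⋃ k, V k) ∧ (∀ k, g k • V k ⊆ O) ∧
      Pairwise fun k l => Disjoint (g k • V k) (g l • V l)

/-- `U ≺ O` for open `U`: every closed subset of `U` is subordinate to `O`. -/
def SubordOpen (G : Type*) [Group G] (X : Type*) [TopologicalSpace X] [MulAction G X]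
    (U O : Set X) : Prop :=
  ∀ C : Set X, IsClosed C → C ⊆ U → Subord G X C O

/-- Dynamical comparison. -/
def DynComparison (G : Type*) [Group G] (X : Type*) [TopologicalSpace X] [MulAction G X]
    [MeasurableSpace X] : Prop :=
  ∀ U O : Set X, IsOpen U → IsOpen O → U.Nonempty → O.Nonempty →
    (∀ μ : Measure X, InvProb G X μ → μ U < μ O) → SubordOpen G X U O

/-- Almost finiteness (Kerr). -/
def AlmostFinite (G X : Type*) [Group G] [MetricSpace X] [MulAction G X] : Prop :=
  ∀ (K : Finset G) (m : ℕ), 0 < m → ∀ ε : ℝ, 0 < ε →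
    ∃ (n : ℕ) (S : Fin n → Finset G) (B : Fin n → Set X),
      IsCastle G X S B ∧ (∀ i, IsOpen (B i)) ∧ (∀ i, IsFolner K (S i) ε) ∧
      (∀ i, ∀ s ∈ S i, Metric.diam (s • B i) < ε) ∧
      ∃ S' : Fin n → Finset G,
        (∀ i, S' i ⊆ S i ∧ ((S' i).card : ℝ) < (S i).card / m) ∧
        Subord G X (Set.univ \ CastleUnion G X S B) (CastleUnion G X S' B)

/-- Almost finiteness in measure (Kerr–Szabó). -/
def AlmostFiniteInMeasure (G X : Type*) [Group G] [MetricSpace X] [MulAction G X]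
    [MeasurableSpace X] : Prop :=
  ∀ (K : Finset G) (ε : ℝ), 0 < ε →
    ∃ (n : ℕ) (S : Fin n → Finset G) (B : Fin n → Set X),
      IsCastle G X S B ∧ (∀ i, IsOpen (B i)) ∧ (∀ i, IsFolner K (S i) ε) ∧
      (∀ i, ∀ s ∈ S i, Metric.diam (s • B i) < ε) ∧
      (⨆ μ : {μ : Measure X // InvProb G X μ},
        (μ : Measure X) (Set.univ \ CastleUnion G X S B)) < ENNReal.ofReal ε

/-- Every finitely generated subgroup is finite. -/
def LocallyFiniteGroup (G : Type*) [Group G] : Prop :=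
  ∀ H : Subgroup G, H.FG → (H : Set G).Finite

/-- `G` is virtually `ℤ`. -/
def VirtuallyZ (G : Type*) [Group G] : Prop :=
  ∃ H : Subgroup G, H.FiniteIndex ∧ Nonempty (H ≃* Multiplicative ℤ)

end Paper

namespace Paper

/-- The `n`-shift of a bi-infinite word: `(n • w)(m) = w(m - n)`. -/
def zShift {A : Type*} (n : ℤ) (w : ℤ → A) : ℤ → A := fun m => w (m - n)

/-- A syndetic subset of `ℤ`. -/
def zSyndetic (R : Set ℤ) : Prop := ∃ K : Finset ℤ, ∀ n : ℤ, ∃ k ∈ K, n - k ∈ R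

/-- `w` is almost periodic for the `ℤ`-shift. -/
def zAP {A : Type*} [TopologicalSpace A] (w : ℤ → A) : Prop :=
  ∀ U ∈ nhds w, zSyndetic {n : ℤ | zShift n w ∈ U}

/-- `w` is balanced: each recurrence set contains a symmetric syndetic set. -/
def zBalanced {A : Type*} [TopologicalSpace A] (w : ℤ → A) : Prop :=
  ∀ U ∈ nhds w, ∃ P : Set ℤ, zSyndetic P ∧ P ⊆ {n : ℤ | zShift n w ∈ U} ∧ ∀ n, n ∈ P ↔ -n ∈ P

/-- The amplified word `ŵ` on the infinite dihedral group `D∞ = DihedralGroup 0`: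
`ŵ(n) = w(n)` on the canonical copy `{r n}` of `ℤ`, and `ŵ(n·t) = w(-n)`,
i.e. `ŵ(sr m) = w(m)` (here `t = sr 0`). -/
def amplify {A : Type*} (w : ℤ → A) : DihedralGroup 0 → A
  | DihedralGroup.r i => w i
  | DihedralGroup.sr i => w i

/-- The left shift action of a group `Γ` on `A^Γ`: `(g • x)(h) = x(g⁻¹ h)`. -/
instance shiftMulAction (Γ A : Type*) [Group Γ] : MulAction Γ (Γ → A) where
  smul g x h := x (g⁻¹ * h)
  one_smul x := funext fun h => by
    show x ((1:Γ)⁻¹ * h) = x h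
    rw [inv_one, one_mul]
  mul_smul g₁ g₂ x := funext fun h => by
    show x ((g₁ * g₂)⁻¹ * h) = x (g₂⁻¹ * (g₁⁻¹ * h))
    rw [mul_inv_rev, mul_assoc]

/-- A syndetic subset of a group `Γ`: `K R = Γ` for some finite `K`. -/
def gSyndetic {Γ : Type*} [Group Γ] (R : Set Γ) : Prop :=
  ∃ K : Finset Γ, ∀ g : Γ, ∃ k ∈ K, k⁻¹ * g ∈ R

/-- `x ∈ A^Γ` is almost periodic for the left shift. -/
def APoint {Γ A : Type*} [Group Γ] [TopologicalSpace A] (x : Γ → A) : Prop :=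
  ∀ U ∈ nhds x, gSyndetic {g : Γ | g • x ∈ U}

/-- The orbit closure `O(x)` of `x ∈ A^Γ` under the left shift. -/
def OrbitClosure (Γ : Type*) [Group Γ] {A : Type*} [TopologicalSpace A] (x : Γ → A) :
    Set (Γ → A) :=
  closure (MulAction.orbit Γ x)

/-- The restriction of the shift action to an orbit closure. -/
instance orbitClosureMulAction (Γ : Type*) [Group Γ] {A : Type*} [TopologicalSpace A]
    (x : Γ → A) : MulAction Γ (OrbitClosure Γ x) where
  smul g y := ⟨g • (y : Γ → A), by
    have hc : Continuous (fun z : Γ → A => g • z) :=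
      continuous_pi fun h => continuous_apply (g⁻¹ * h)
    have h2 := image_closure_subset_closure_image (s := MulAction.orbit Γ x) hc
      ⟨(y : Γ → A), y.2, rfl⟩
    have h3 : (fun z : Γ → A => g • z) '' MulAction.orbit Γ x = MulAction.orbit Γ x := by
      rw [Set.image_smul, MulAction.smul_orbit]
    rw [h3] at h2
    exact h2⟩
  one_smul y := Subtype.ext (one_smul Γ (y : Γ → A))
  mul_smul g₁ g₂ y := Subtype.ext (mul_smul g₁ g₂ (y : Γ → A))

end Paper

namespace Paper

/-- The rotation `r n`, indexed by an integer. -/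
def rot (n : ℤ) : DihedralGroup 0 := DihedralGroup.r n

/-- The reflection `sr n`, indexed by an integer. -/
def refl (n : ℤ) : DihedralGroup 0 := DihedralGroup.sr n

lemma rot_or_refl (g : DihedralGroup 0) : (∃ n, g = rot n) ∨ ∃ n, g = refl n := by
  cases g with
  | r i => exact Or.inl ⟨i, rfl⟩
  | sr i => exact Or.inr ⟨i, rfl⟩

lemma rot_injective : Function.Injective rot := fun _ _ h => DihedralGroup.r.inj h

lemma refl_injective : Function.Injective refl := fun _ _ h => DihedralGroup.sr.inj h

lemma rot_ne_refl (a b : ℤ) : rot a ≠ refl b := by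
  intro h
  cases h

lemma rot_mul_rot (a b : ℤ) : rot a * rot b = rot (a + b) := rfl
lemma rot_mul_refl (a b : ℤ) : rot a * refl b = refl (b - a) := rfl
lemma refl_mul_rot (a b : ℤ) : refl a * rot b = refl (a + b) := rfl
lemma refl_mul_refl (a b : ℤ) : refl a * refl b = rot (b - a) := rfl
lemma rot_zero : rot 0 = 1 := rfl
lemma rot_inv (a : ℤ) : (rot a)⁻¹ = rot (-a) := rfl
lemma refl_inv (a : ℤ) : (refl a)⁻¹ = refl a := rfl

section Action

variable {X : Type*} [MulAction (DihedralGroup 0) X]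

lemma rot_smul_rot_smul (a b : ℤ) (x : X) : rot a • rot b • x = rot (a + b) • x := by
  rw [smul_smul, rot_mul_rot]

lemma rot_smul_refl_smul (a b : ℤ) (x : X) : rot a • refl b • x = refl (b - a) • x := by
  rw [smul_smul, rot_mul_refl]

lemma refl_smul_rot_smul (a b : ℤ) (x : X) : refl a • rot b • x = refl (a + b) • x := by
  rw [smul_smul, refl_mul_rot]

lemma refl_smul_refl_smul (a b : ℤ) (x : X) : refl a • refl b • x = rot (b - a) • x := by
  rw [smul_smul, refl_mul_refl]

lemma rot_zero_smul (x : X) : rot 0 • x = x := by rw [rot_zero, one_smul]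

/-- The first positive time at which the orbit of `x` under rotations enters `Y`. -/
noncomputable def hitTime (Y : Set X) (x : X) : ℕ := sInf {n : ℕ | 0 < n ∧ rot n • x ∈ Y}

/-- The first point of `Y` on the forward orbit of `x` under rotations. -/
noncomputable def firstHit (Y : Set X) (x : X) : X := rot (hitTime Y x) • x

/-- The first hit of `Y`, followed by the reflection `refl 0`. -/
noncomputable def flipHit (Y : Set X) (x : X) : X := refl (hitTime Y x) • x

/-- The time of the `j`-th hit of `Y`. -/
noncomputable def iterHitTime (Y : Set X) (j : ℕ) (x : X) : ℕ :=
  ∑ i ∈ Finset.range j, hitTime Y ((firstHit Y)^[i] x)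

variable {Y : Set X}

lemma hitTime_spec (hrec : ∀ x : X, ∃ n : ℕ, 0 < n ∧ rot n • x ∈ Y) (x : X) :
    0 < hitTime Y x ∧ rot (hitTime Y x) • x ∈ Y :=
  Nat.sInf_mem (s := {n : ℕ | 0 < n ∧ rot n • x ∈ Y}) (hrec x)

lemma hitTime_le {n : ℕ} {x : X} (hn : 0 < n) (h : rot n • x ∈ Y) : hitTime Y x ≤ n :=
  Nat.sInf_le ⟨hn, h⟩

lemma hitTime_eq {n : ℕ} {x : X} (hn : 0 < n) (h : rot n • x ∈ Y)
    (hmin : ∀ i : ℕ, 0 < i → i < n → rot i • x ∉ Y) : hitTime Y x = n := by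
  have hs : 0 < hitTime Y x ∧ rot (hitTime Y x) • x ∈ Y :=
    Nat.sInf_mem (s := {n : ℕ | 0 < n ∧ rot n • x ∈ Y}) ⟨n, hn, h⟩
  refine le_antisymm (hitTime_le hn h) ?_
  by_contra hlt
  exact hmin _ hs.1 (by omega) hs.2

lemma eq_of_rot_smul_eq {a b : ℕ} {x y : X} (hx : x ∈ Y) (hy : y ∈ Y)
    (ha : a < hitTime Y x) (hb : b < hitTime Y y) (h : rot a • x = rot b • y) :
    a = b ∧ x = y := by
  have key : ∀ {a b : ℕ} {x y : X}, y ∈ Y → a < hitTime Y x → a ≥ b →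
      rot a • x = rot b • y → a = b ∧ x = y := by
    intro a b x y hy ha hab h
    have h1 : rot ((a - b : ℕ) : ℤ) • x = y := by
      have := congrArg (fun z => rot (-b) • z) h
      simp only [rot_smul_rot_smul, neg_add_cancel, rot_zero_smul] at this
      rw [← this]; congr 2; omega
    rcases Nat.eq_zero_or_pos (a - b) with h0 | h0
    · rw [h0, Nat.cast_zero, rot_zero_smul] at h1
      exact ⟨by omega, h1⟩
    · have := hitTime_le (Y := Y) (x := x) h0 (by rw [h1]; exact hy)
      omega
  rcases le_total b a with hab | hab
  · exact key hy ha hab h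
  · have := key hx hb hab h.symm
    exact ⟨this.1.symm, this.2.symm⟩

lemma firstHit_injOn (hrec : ∀ x : X, ∃ n : ℕ, 0 < n ∧ rot n • x ∈ Y) :
    Set.InjOn (firstHit Y) Y := by
  have key : ∀ {x y : X}, x ∈ Y → hitTime Y x ≤ hitTime Y y → firstHit Y x = firstHit Y y →
      x = y := by
    intro x y hx hle h
    have h1 : rot (0 : ℕ) • x = rot ((hitTime Y y - hitTime Y x : ℕ) : ℤ) • y := by
      have := congrArg (fun z => rot (-(hitTime Y x : ℤ)) • z) h
      simp only [firstHit, rot_smul_rot_smul, neg_add_cancel, rot_zero_smul] at this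
      rw [Nat.cast_zero, rot_zero_smul, Nat.cast_sub hle, sub_eq_neg_add]
      exact this
    rcases Nat.eq_zero_or_pos (hitTime Y y - hitTime Y x) with h0 | h0
    · simpa only [h0, Nat.cast_zero, rot_zero_smul] using h1
    · have := hitTime_le (Y := Y) (x := y) h0 (by
        rw [← h1, Nat.cast_zero, rot_zero_smul]; exact hx)
      have := (hitTime_spec hrec x).1
      omega
  intro x hx y hy h
  rcases le_total (hitTime Y x) (hitTime Y y) with hle | hle
  · exact key hx hle h
  · exact (key hy hle h.symm).symm

lemma firstHit_mem (hrec : ∀ x : X, ∃ n : ℕ, 0 < n ∧ rot n • x ∈ Y) (x : X) :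
    firstHit Y x ∈ Y := (hitTime_spec hrec x).2

lemma firstHit_mapsTo (hrec : ∀ x : X, ∃ n : ℕ, 0 < n ∧ rot n • x ∈ Y) :
    Set.MapsTo (firstHit Y) Y Y := fun x _ => firstHit_mem hrec x

lemma iterate_firstHit (j : ℕ) (x : X) :
    (firstHit Y)^[j] x = rot (iterHitTime Y j x) • x := by
  induction j with
  | zero => simp [iterHitTime, rot_zero_smul]
  | succ j ih =>
    have h : iterHitTime Y (j + 1) x =
        iterHitTime Y j x + hitTime Y ((firstHit Y)^[j] x) := by
      rw [iterHitTime, Finset.sum_range_succ, iterHitTime]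
    rw [Function.iterate_succ_apply', h]
    conv_lhs => rw [firstHit]
    conv_lhs => rw [ih]
    rw [rot_smul_rot_smul, ← ih]
    congr 2
    push_cast
    ring

lemma hitTime_le_iterHitTime {j : ℕ} (hj : 0 < j) (x : X) :
    hitTime Y x ≤ iterHitTime Y j x :=
  Finset.single_le_sum (f := fun i => hitTime Y ((firstHit Y)^[i] x)) (fun _ _ => Nat.zero_le _)
    (Finset.mem_range.2 hj)

lemma iterHitTime_le {L : ℕ} (hL : ∀ x, hitTime Y x ≤ L) (j : ℕ) (x : X) :
    iterHitTime Y j x ≤ j * L := by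
  simpa [iterHitTime] using Finset.sum_le_card_nsmul (Finset.range j)
    (fun i => hitTime Y ((firstHit Y)^[i] x)) L fun i _ => hL _

lemma eq_of_iterate_firstHit_eq {W : Set X} {L : ℕ}
    (hrec : ∀ x : X, ∃ n : ℕ, 0 < n ∧ rot n • x ∈ Y) (hWY : W ⊆ Y)
    (hW : ∀ d : ℕ, 0 < d → d ≤ L → ∀ y ∈ W, (firstHit Y)^[d] y ∉ W)
    {i j : ℕ} {x y : X} (hx : x ∈ W) (hy : y ∈ W) (hi : i ≤ L) (hj : j ≤ L)
    (h : (firstHit Y)^[i] x = (firstHit Y)^[j] y) : i = j ∧ x = y := by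
  have key : ∀ {i j : ℕ} {x y : X}, x ∈ W → y ∈ W → j ≤ L → i ≤ j →
      (firstHit Y)^[i] x = (firstHit Y)^[j] y → i = j ∧ x = y := by
    intro i j x y hx hy hj hij h
    obtain ⟨d, rfl⟩ := Nat.exists_eq_add_of_le hij
    rw [Function.iterate_add_apply] at h
    have h1 : x = (firstHit Y)^[d] y :=
      (firstHit_injOn hrec).iterate (firstHit_mapsTo hrec) i (hWY hx)
        ((firstHit_mapsTo hrec).iterate d (hWY hy)) h
    rcases Nat.eq_zero_or_pos d with rfl | hd
    · exact ⟨rfl, h1⟩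
    · exact absurd (h1 ▸ hx) (hW d hd (by omega) y hy)
  rcases le_total i j with hij | hij
  · exact key hx hy hj hij h
  · have := key hy hx hi hij h.symm
    exact ⟨this.1.symm, this.2.symm⟩

section Flip

variable (hrec : ∀ x : X, ∃ n : ℕ, 0 < n ∧ rot n • x ∈ Y)
  (hsym : ∀ x ∈ Y, refl 0 • x ∈ Y)

lemma refl_zero_smul_mem_iff (hsym : ∀ x ∈ Y, refl 0 • x ∈ Y) (x : X) :
    refl 0 • x ∈ Y ↔ x ∈ Y := by
  refine ⟨fun h => ?_, hsym x⟩
  simpa [refl_smul_refl_smul, rot_zero_smul] using hsym _ h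

lemma flipHit_eq (x : X) : flipHit Y x = refl 0 • firstHit Y x := by
  rw [flipHit, firstHit, refl_smul_rot_smul, zero_add]

include hrec hsym

lemma flipHit_mem (x : X) : flipHit Y x ∈ Y := by
  rw [flipHit_eq]
  exact hsym _ (firstHit_mem hrec x)

lemma hitTime_flipHit {x : X} (hx : x ∈ Y) : hitTime Y (flipHit Y x) = hitTime Y x := by
  have hmem : ∀ i : ℕ, i ≤ hitTime Y x →
      (rot i • flipHit Y x ∈ Y ↔ rot ((hitTime Y x - i : ℕ) : ℤ) • x ∈ Y) := by
    intro i hi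
    rw [← refl_zero_smul_mem_iff hsym, flipHit, rot_smul_refl_smul, refl_smul_refl_smul]
    have : (hitTime Y x : ℤ) - i - 0 = ((hitTime Y x - i : ℕ) : ℤ) := by omega
    rw [this]
  refine hitTime_eq (hitTime_spec hrec x).1 ?_ ?_
  · rw [hmem _ le_rfl, Nat.sub_self, Nat.cast_zero, rot_zero_smul]
    exact hx
  · intro i hi hi' h
    rw [hmem _ hi'.le] at h
    have := hitTime_le (Y := Y) (by omega) h
    omega

lemma flipHit_flipHit {x : X} (hx : x ∈ Y) : flipHit Y (flipHit Y x) = x := by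
  conv_lhs => rw [flipHit, hitTime_flipHit hrec hsym hx, flipHit]
  rw [refl_smul_refl_smul, sub_self, rot_zero_smul]

lemma exists_eq_rot_smul (x : X) :
    ∃ a : ℕ, ∃ y ∈ Y, a < hitTime Y y ∧ x = rot a • y := by
  classical
  have hback : ∃ n : ℕ, rot (-(n : ℤ)) • x ∈ Y := by
    obtain ⟨n, -, hn⟩ := hrec (refl 0 • x)
    refine ⟨n, ?_⟩
    rw [← refl_zero_smul_mem_iff hsym]
    rw [rot_smul_refl_smul] at hn
    rw [refl_smul_rot_smul]
    convert hn using 3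
    ring
  refine ⟨Nat.find hback, rot (-(Nat.find hback : ℤ)) • x, Nat.find_spec hback, ?_, ?_⟩
  · by_contra hlt
    rw [not_lt] at hlt
    set y := rot (-(Nat.find hback : ℤ)) • x with hy
    obtain ⟨hpos, hm⟩ := hitTime_spec hrec y
    have : rot (-((Nat.find hback - hitTime Y y : ℕ) : ℤ)) • x ∈ Y := by
      rw [hy, rot_smul_rot_smul, ← hy] at hm
      convert hm using 3
      omega
    have := Nat.find_min' hback this
    omega
  · rw [rot_smul_rot_smul, add_neg_cancel, rot_zero_smul]

end Flip

lemma iterate_firstHit_ne_of_flipHit_fixed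
    (hrec : ∀ x : X, ∃ n : ℕ, 0 < n ∧ rot n • x ∈ Y)
    (hfree : ∀ (n : ℤ) (x : X), rot n • x = x → n = 0) {x y : X}
    (hx : flipHit Y x = x) (hy : flipHit Y y = y) {d : ℕ} (hd : 0 < d) :
    (firstHit Y)^[d] y ≠ x := by
  intro h
  rw [iterate_firstHit] at h
  have hle := hitTime_le_iterHitTime (Y := Y) hd y
  have hpos := (hitTime_spec hrec y).1
  generalize iterHitTime Y d y = n at h hle
  rw [flipHit] at hx hy
  have hx' : refl ((hitTime Y y : ℤ) - 2 * n) • x = x := by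
    conv_rhs => rw [← h, ← hy]
    rw [← h, refl_smul_rot_smul, rot_smul_refl_smul]
    congr 2
    ring
  have h2 : rot (hitTime Y x - ((hitTime Y y : ℤ) - 2 * n)) • x = x := by
    rw [← refl_smul_refl_smul, hx, hx']
  have := hfree _ _ h2
  omega

end Action

section Topology

variable {X : Type*} [MulAction (DihedralGroup 0) X] [TopologicalSpace X]
  [ContinuousConstSMul (DihedralGroup 0) X] {Y : Set X}

lemma continuous_hitTime (hY : IsClopen Y)
    (hrec : ∀ x : X, ∃ n : ℕ, 0 < n ∧ rot n • x ∈ Y) : Continuous (hitTime Y) := by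
  refine IsLocallyConstant.continuous ((IsLocallyConstant.iff_eventually_eq _).2 fun x => ?_)
  obtain ⟨hpos, hm⟩ := hitTime_spec hrec x
  have hin : ∀ᶠ y in nhds x, rot (hitTime Y x) • y ∈ Y :=
    (continuous_const_smul _).continuousAt.eventually_mem (hY.isOpen.mem_nhds hm)
  have hout : ∀ᶠ y in nhds x, ∀ i ∈ Finset.Ioo 0 (hitTime Y x), rot (i : ℤ) • y ∈ Yᶜ := by
    rw [Filter.eventually_all_finset]
    intro i hi
    rw [Finset.mem_Ioo] at hi
    refine (continuous_const_smul _).continuousAt.eventually_mem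
      (hY.compl.isOpen.mem_nhds fun h => ?_)
    have := hitTime_le hi.1 h
    omega
  filter_upwards [hin, hout] with y h1 h2
  exact hitTime_eq hpos h1 fun i hi hi' => h2 i (Finset.mem_Ioo.2 ⟨hi, hi'⟩)

lemma continuous_smul_of_continuous_index {f : X → ℕ} (hf : Continuous f)
    (g : ℕ → DihedralGroup 0) : Continuous fun x => g (f x) • x := by
  refine continuous_iff_continuousAt.2 fun x => ?_
  have h : (fun y => g (f x) • y) =ᶠ[nhds x] fun y => g (f y) • y := by
    filter_upwards [hf.continuousAt.eventually_mem ((isOpen_discrete {f x}).mem_nhds rfl)]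
      with y hy
    rw [Set.mem_singleton_iff.1 hy]
  exact (continuous_const_smul (g (f x))).continuousAt.congr h

lemma continuous_firstHit (hY : IsClopen Y)
    (hrec : ∀ x : X, ∃ n : ℕ, 0 < n ∧ rot n • x ∈ Y) : Continuous (firstHit Y) :=
  continuous_smul_of_continuous_index (continuous_hitTime hY hrec) fun n => rot n

lemma continuous_flipHit (hY : IsClopen Y)
    (hrec : ∀ x : X, ∃ n : ℕ, 0 < n ∧ rot n • x ∈ Y) : Continuous (flipHit Y) :=
  continuous_smul_of_continuous_index (continuous_hitTime hY hrec) fun n => refl n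

lemma continuous_iterHitTime (hY : IsClopen Y)
    (hrec : ∀ x : X, ∃ n : ℕ, 0 < n ∧ rot n • x ∈ Y) (j : ℕ) : Continuous (iterHitTime Y j) :=
  continuous_finsetSum _ fun i _ =>
    (continuous_hitTime hY hrec).comp ((continuous_firstHit hY hrec).iterate i)

end Topology

section Tower

/-- The tower shape consisting of the rotations `rot i`, `a ≤ i < b`, and the reflections
`refl i`, `a < i ≤ b`. -/
noncomputable def dihedralBox (a b : ℤ) : Finset (DihedralGroup 0) :=
  ((Finset.Ico a b).map ⟨rot, rot_injective⟩).disjUnion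
    ((Finset.Ioc a b).map ⟨refl, refl_injective⟩) (by
      rw [Finset.disjoint_left]
      intro g h1 h2
      obtain ⟨i, -, rfl⟩ := Finset.mem_map.1 h1
      obtain ⟨j, -, h⟩ := Finset.mem_map.1 h2
      exact rot_ne_refl _ _ h.symm)

lemma rot_mem_dihedralBox {a b i : ℤ} : rot i ∈ dihedralBox a b ↔ a ≤ i ∧ i < b := by
  simp only [dihedralBox, Finset.mem_disjUnion, Finset.mem_map, Finset.mem_Ico, Finset.mem_Ioc,
    Function.Embedding.coeFn_mk]
  constructor
  · rintro (⟨j, hj, h⟩ | ⟨j, hj, h⟩)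
    · rwa [← rot_injective h]
    · exact absurd h.symm (rot_ne_refl _ _)
  · exact fun h => Or.inl ⟨i, h, rfl⟩

lemma refl_mem_dihedralBox {a b i : ℤ} : refl i ∈ dihedralBox a b ↔ a < i ∧ i ≤ b := by
  simp only [dihedralBox, Finset.mem_disjUnion, Finset.mem_map, Finset.mem_Ico, Finset.mem_Ioc,
    Function.Embedding.coeFn_mk]
  constructor
  · rintro (⟨j, hj, h⟩ | ⟨j, hj, h⟩)
    · exact absurd h (rot_ne_refl _ _)
    · rwa [← refl_injective h]
  · exact fun h => Or.inr ⟨i, h, rfl⟩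

lemma card_dihedralBox (a b : ℤ) : (dihedralBox a b).card = 2 * (b - a).toNat := by
  rw [dihedralBox, Finset.card_disjUnion]
  simp [two_mul]

lemma dihedralBox_subset {a b c d : ℤ} (h1 : c ≤ a) (h2 : b ≤ d) :
    dihedralBox a b ⊆ dihedralBox c d := by
  intro g hg
  rcases rot_or_refl g with ⟨i, rfl⟩ | ⟨i, rfl⟩
  · rw [rot_mem_dihedralBox] at hg ⊢
    omega
  · rw [refl_mem_dihedralBox] at hg ⊢
    omega

lemma exists_index_bound (K : Finset (DihedralGroup 0)) :
    ∃ c : ℕ, ∀ g ∈ K, ∀ i : ℤ, g = rot i ∨ g = refl i → -(c : ℤ) < i ∧ i < c := by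
  let idx : DihedralGroup 0 → ℤ := fun g => match g with
    | DihedralGroup.r i => i
    | DihedralGroup.sr i => i
  refine ⟨K.sup (fun g => (idx g).natAbs) + 1, fun g hg i hi => ?_⟩
  have h1 : (idx g).natAbs ≤ K.sup (fun g => (idx g).natAbs) :=
    Finset.le_sup (f := fun g => (idx g).natAbs) hg
  have h2 : idx g = i := by rcases hi with rfl | rfl <;> rfl
  rw [h2] at h1
  omega

lemma card_mul_dihedralBox_sdiff_le [DecidableEq (DihedralGroup 0)]
    {K : Finset (DihedralGroup 0)} {c : ℕ}
    (hc : ∀ g ∈ K, ∀ i : ℤ, g = rot i ∨ g = refl i → -(c : ℤ) < i ∧ i < c) (k : ℕ) :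
    ((K * dihedralBox 0 k) \ dihedralBox 0 k).card ≤ 4 * c := by
  have hsub : K * dihedralBox 0 k ⊆ dihedralBox (-c) (k + c) := by
    intro g hg
    obtain ⟨p, hp, q, hq, rfl⟩ := Finset.mem_mul.1 hg
    rcases rot_or_refl p with ⟨i, rfl⟩ | ⟨i, rfl⟩ <;> rcases rot_or_refl q with ⟨j, rfl⟩ | ⟨j, rfl⟩
    all_goals
      have := hc _ hp i (by simp)
      simp only [rot_mem_dihedralBox, refl_mem_dihedralBox, rot_mul_rot, rot_mul_refl,
        refl_mul_rot, refl_mul_refl] at hq ⊢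
      omega
  calc ((K * dihedralBox 0 k) \ dihedralBox 0 k).card
      ≤ (dihedralBox (-c) (k + c) \ dihedralBox 0 k).card :=
        Finset.card_le_card (Finset.sdiff_subset_sdiff hsub le_rfl)
    _ = 4 * c := by
        rw [Finset.card_sdiff_of_subset (dihedralBox_subset (by omega) (by omega)),
          card_dihedralBox, card_dihedralBox]
        omega

lemma exists_isFolner_dihedralBox (K : Finset (DihedralGroup 0)) {ε : ℝ} (hε : 0 < ε) :
    ∃ N : ℕ, ∀ k : ℕ, N ≤ k → IsFolner K (dihedralBox 0 k) ε := by
  obtain ⟨c, hc⟩ := exists_index_bound K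
  obtain ⟨N, hN⟩ := exists_nat_gt (2 * c / ε)
  refine ⟨N, fun k hk => ?_⟩
  let _ := Classical.decEq (DihedralGroup 0)
  have h1 : (((K * dihedralBox 0 k) \ dihedralBox 0 k).card : ℝ) ≤ 4 * c := by
    exact_mod_cast card_mul_dihedralBox_sdiff_le hc k
  have h2 : ((dihedralBox 0 k).card : ℝ) = 2 * k := by
    rw [card_dihedralBox]
    simp
  have h3 : 2 * (c : ℝ) < ε * k := by
    rw [div_lt_iff₀ hε] at hN
    have : (N : ℝ) ≤ k := by exact_mod_cast hk
    nlinarith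
  show (((K * dihedralBox 0 k) \ dihedralBox 0 k).card : ℝ) < ε * (dihedralBox 0 k).card
  rw [h2]
  linarith

lemma subord_of_fintype {G X ι : Type*} [Group G] [TopologicalSpace X] [MulAction G X] [Fintype ι]
    {C O : Set X} (V : ι → Set X) (g : ι → G) (hV : ∀ k, IsOpen (V k)) (hC : C ⊆ ⋃ k, V k)
    (hO : ∀ k, g k • V k ⊆ O) (hd : Pairwise fun k l => Disjoint (g k • V k) (g l • V l)) :
    Subord G X C O := by
  let e := (Fintype.equivFin ι).symm
  refine ⟨Fintype.card ι, V ∘ e, g ∘ e, fun k => hV _, ?_, fun k => hO _, ?_⟩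
  · intro x hx
    obtain ⟨k, hk⟩ := Set.mem_iUnion.1 (hC hx)
    exact Set.mem_iUnion.2 ⟨e.symm k, by simpa using hk⟩
  · exact fun k l hkl => hd fun h => hkl (e.injective h)

end Tower

section Reflections

variable {X : Type*} [MulAction (DihedralGroup 0) X] [TopologicalSpace X] [CompactSpace X]
  [T2Space X] [TotallyDisconnectedSpace X] [ContinuousConstSMul (DihedralGroup 0) X] {Y : Set X}

lemma exists_isClopen_nhds_flipHit_fixed (hY : IsClopen Y)
    (hrec : ∀ x : X, ∃ n : ℕ, 0 < n ∧ rot n • x ∈ Y) (hsym : ∀ x ∈ Y, refl 0 • x ∈ Y)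
    (hfree : ∀ (n : ℤ) (x : X), rot n • x = x → n = 0) (L : ℕ) :
    ∃ W : Set X, IsClopen W ∧ W ⊆ Y ∧ (∀ y ∈ Y, flipHit Y y = y → y ∈ W) ∧
      (∀ y ∈ W, flipHit Y y ∈ W) ∧
      ∀ d : ℕ, 0 < d → d ≤ L → ∀ y ∈ W, (firstHit Y)^[d] y ∉ W := by
  set F : Set X := {y | y ∈ Y ∧ flipHit Y y = y} with hF
  have hFc : IsClosed F :=
    hY.isClosed.inter (isClosed_eq (continuous_flipHit hY hrec) continuous_id)
  have hρ : ∀ d, Continuous ((firstHit Y)^[d]) := fun d => (continuous_firstHit hY hrec).iterate d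
  have hU : ∀ d : ℕ, ∃ U : Set X, IsClopen U ∧ F ⊆ U ∧
      (0 < d → ∀ y ∈ F, (firstHit Y)^[d] y ∉ U) := by
    intro d
    rcases Nat.eq_zero_or_pos d with rfl | hd
    · exact ⟨Set.univ, isClopen_univ, Set.subset_univ _, fun h => absurd h (lt_irrefl _)⟩
    · have hcl : IsClosed ((firstHit Y)^[d] '' F) := (hFc.isCompact.image (hρ d)).isClosed
      obtain ⟨C, hC, hFC, hCU⟩ := exists_clopen_of_closed_subset_open hFc hcl.isOpen_compl (by
        rintro x hx ⟨y, hy, rfl⟩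
        exact iterate_firstHit_ne_of_flipHit_fixed hrec hfree hx.2 hy.2 hd rfl)
      exact ⟨C, hC, hFC, fun _ y hy h => hCU h ⟨y, hy, rfl⟩⟩
  choose U hUc hFU hUd using hU
  set W₀ : Set X := Y ∩ ⋂ d ∈ Finset.Icc 1 L, (U d ∩ (firstHit Y)^[d] ⁻¹' (U d)ᶜ) with hW₀
  have hW₀c : IsClopen W₀ := hY.inter (isClopen_biInter_finset fun d _ =>
    (hUc d).inter ((hUc d).compl.preimage (hρ d)))
  have hFW₀ : F ⊆ W₀ := by
    intro y hy
    refine ⟨hy.1, Set.mem_iInter₂.2 fun d hd => ⟨hFU d hy, hUd d ?_ y hy⟩⟩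
    exact (Finset.mem_Icc.1 hd).1
  refine ⟨W₀ ∩ flipHit Y ⁻¹' W₀, hW₀c.inter (hW₀c.preimage (continuous_flipHit hY hrec)),
    fun y hy => hy.1.1, fun y hy h => ⟨hFW₀ ⟨hy, h⟩, ?_⟩, fun y hy => ⟨hy.2, ?_⟩, ?_⟩
  · show flipHit Y y ∈ W₀
    rw [h]
    exact hFW₀ ⟨hy, h⟩
  · show flipHit Y (flipHit Y y) ∈ W₀
    rw [flipHit_flipHit hrec hsym hy.1.1]
    exact hy.1
  · intro d hd hdL y hy h
    have hd' : d ∈ Finset.Icc 1 L := Finset.mem_Icc.2 ⟨hd, hdL⟩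
    exact (Set.mem_iInter₂.1 hy.1.2 d hd').2 (Set.mem_iInter₂.1 h.1.2 d hd').1

end Reflections

section Castle

variable {X : Type*} [MulAction (DihedralGroup 0) X] [MetricSpace X] [CompactSpace X]
  [TotallyDisconnectedSpace X] [ContinuousConstSMul (DihedralGroup 0) X] {Y Z : Set X}

lemma exists_small_isClopen_nhds (hY : IsClopen Y) (hZ : IsClopen Z)
    (hrec : ∀ x : X, ∃ n : ℕ, 0 < n ∧ rot n • x ∈ Y)
    {ε : ℝ} (hε : 0 < ε) {y : X} (hy : y ∈ Z) (hne : flipHit Y y ≠ y) :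
    ∃ B : Set X, IsClopen B ∧ y ∈ B ∧ B ⊆ Z ∧ (∀ z ∈ B, hitTime Y z = hitTime Y y) ∧
      (∀ z ∈ B, flipHit Y z ∉ B) ∧
      ∀ s ∈ dihedralBox 0 (hitTime Y y), ∀ z ∈ B, dist (s • z) (s • y) < ε := by
  obtain ⟨V, hV, hyV, hVs⟩ := compact_exists_isClopen_in_isOpen
    (isOpen_compl_singleton (x := flipHit Y y)) hne.symm
  have hev : ∀ᶠ z in nhds y, (z ∈ Z ∧ hitTime Y z = hitTime Y y ∧ z ∈ V ∧ flipHit Y z ∈ Vᶜ) ∧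
      ∀ s ∈ dihedralBox 0 (hitTime Y y), dist (s • z) (s • y) < ε := by
    refine Filter.Eventually.and ?_ ?_
    · have hyZ : ∀ᶠ z in nhds y, z ∈ Z := hZ.isOpen.mem_nhds hy
      have hyV' : ∀ᶠ z in nhds y, z ∈ V := hV.isOpen.mem_nhds hyV
      refine hyZ.and (Filter.Eventually.and ?_ (hyV'.and ?_))
      · exact (continuous_hitTime hY hrec).continuousAt.eventually_mem
          ((isOpen_discrete {hitTime Y y}).mem_nhds rfl)
      · exact (continuous_flipHit hY hrec).continuousAt.eventually_mem
          (hV.compl.isOpen.mem_nhds fun h => hVs h rfl)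
    · rw [Filter.eventually_all_finset]
      intro s _
      exact (continuous_const_smul s).continuousAt.eventually_mem (Metric.ball_mem_nhds _ hε)
  obtain ⟨B, ⟨hyB, hB⟩, hsub⟩ := (nhds_basis_clopen y).mem_iff.1 hev
  exact ⟨B, hB, hyB, fun z hz => (hsub hz).1.1, fun z hz => (hsub hz).1.2.1,
    fun z hz h => (hsub hz).1.2.2.2 (hsub h).1.2.2.1, fun s hs z hz => (hsub hz).2 s hs⟩

lemma exists_tower_bases (hY : IsClopen Y) (hZ : IsClopen Z) (hZY : Z ⊆ Y)
    (hrec : ∀ x : X, ∃ n : ℕ, 0 < n ∧ rot n • x ∈ Y) (hsym : ∀ x ∈ Y, refl 0 • x ∈ Y)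
    (hne : ∀ y ∈ Z, flipHit Y y ≠ y) {ε : ℝ} (hε : 0 < ε) :
    ∃ (n : ℕ) (B : Fin n → Set X) (k : Fin n → ℕ), (∀ i, IsOpen (B i)) ∧ (∀ i, B i ⊆ Z) ∧
      (∀ i, ∀ y ∈ B i, hitTime Y y = k i) ∧ (∀ i, ∃ y ∈ Y, hitTime Y y = k i) ∧
      (∀ i j, ∀ y ∈ B i, flipHit Y y ∉ B j) ∧ (∀ i j, ∀ y ∈ B i, y ∈ B j → i = j) ∧
      (∀ i, ∀ s ∈ dihedralBox 0 (k i), Metric.diam (s • B i) < ε) ∧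
      ∀ y ∈ Z, ∃ i, y ∈ B i ∨ flipHit Y y ∈ B i := by
  choose! U hUc hyU hUZ hUk hUf hUd using fun y (hy : y ∈ Z) =>
    exists_small_isClopen_nhds hY hZ hrec (show 0 < ε / 3 by positivity) hy (hne y hy)
  obtain ⟨T, hTZ, hcov⟩ := hZ.isClosed.isCompact.elim_nhds_subcover U
    fun y hy => (hUc y hy).isOpen.mem_nhds (hyU y hy)
  let e := T.equivFin.symm
  let c : Fin T.card → X := fun i => (e i : X)
  have hc : ∀ i, c i ∈ Z := fun i => hTZ _ (e i).2
  let D : Fin T.card → Set X := fun i => U (c i) ∪ flipHit Y ⁻¹' U (c i)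
  let B : Fin T.card → Set X := fun i => U (c i) \ ⋃ j ∈ Finset.univ.filter (· < i), D j
  have hBU : ∀ i, B i ⊆ U (c i) := fun i => Set.sdiff_subset
  have hBD : ∀ {i j y}, j < i → y ∈ B i → y ∉ D j := fun {i j y} hji hy h =>
    hy.2 (Set.mem_iUnion₂.2 ⟨j, by simpa using hji, h⟩)
  have hDf : ∀ {i y}, y ∈ Y → y ∈ D i → flipHit Y y ∈ D i := by
    rintro i y hy (h | h)
    · refine Or.inr ?_
      rwa [Set.mem_preimage, flipHit_flipHit hrec hsym hy]
    · exact Or.inl h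
  refine ⟨T.card, B, fun i => hitTime Y (c i), ?_, fun i => (hBU i).trans (hUZ _ (hc i)),
    fun i y hy => hUk _ (hc i) y (hBU i hy), fun i => ⟨c i, hZY (hc i), rfl⟩, ?_, ?_, ?_, ?_⟩
  · intro i
    have hDc : ∀ j, IsClopen (D j) := fun j =>
      (hUc _ (hc j)).union ((hUc _ (hc j)).preimage (continuous_flipHit hY hrec))
    exact ((hUc _ (hc i)).diff (isClopen_biUnion_finset fun j _ => hDc j)).isOpen
  · intro i j y hy h
    have hyY : y ∈ Y := hZY (hUZ _ (hc i) (hBU i hy))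
    rcases lt_trichotomy i j with hij | rfl | hij
    · exact hBD hij h (hDf hyY (Or.inl (hBU i hy)))
    · exact hUf _ (hc i) y (hBU i hy) (hBU i h)
    · exact hBD hij hy (Or.inr (hBU j h))
  · intro i j y hi hj
    rcases lt_trichotomy i j with hij | rfl | hij
    · exact absurd (Or.inl (hBU i hi)) (hBD hij hj)
    · rfl
    · exact absurd (Or.inl (hBU j hj)) (hBD hij hi)
  · intro i s hs
    refine (Metric.diam_le_of_forall_dist_le (C := 2 * ε / 3) (by positivity) ?_).trans_lt
      (by linarith)
    rintro _ ⟨y, hy, rfl⟩ _ ⟨z, hz, rfl⟩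
    have h1 := hUd _ (hc i) s hs y (hBU i hy)
    have h2 := hUd _ (hc i) s hs z (hBU i hz)
    have h3 := dist_triangle_right (s • y) (s • z) (s • c i)
    simp only [] at h3 ⊢
    linarith
  · intro y hy
    have hex : ∃ i, y ∈ D i := by
      obtain ⟨x, hx, hyx⟩ := Set.mem_iUnion₂.1 (hcov hy)
      refine ⟨e.symm ⟨x, hx⟩, Or.inl ?_⟩
      simpa [c] using hyx
    obtain ⟨i, hi, hmin⟩ := WellFounded.has_min (wellFounded_lt (α := Fin T.card))
      {i | y ∈ D i} hex
    have hyY := hZY hy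
    have hmem : ∀ z, z ∈ U (c i) → (∀ j, j < i → z ∉ D j) → z ∈ B i := by
      intro z hz hzD
      refine ⟨hz, fun h => ?_⟩
      obtain ⟨j, hj, hzj⟩ := Set.mem_iUnion₂.1 h
      exact hzD j (by simpa using hj) hzj
    rcases hi with h | h
    · exact ⟨i, Or.inl (hmem y h fun j hj hyD => hmin j hyD hj)⟩
    · refine ⟨i, Or.inr (hmem _ h fun j hj hyD => hmin j ?_ hj)⟩
      have := hDf (flipHit_mem hrec hsym y) hyD
      rwa [flipHit_flipHit hrec hsym hyY] at this

end Castle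

section AlmostFinite

variable {X : Type*} [MulAction (DihedralGroup 0) X]

lemma exists_isClopen_symm_nhds [TopologicalSpace X] [CompactSpace X] [T2Space X]
    [TotallyDisconnectedSpace X] [ContinuousConstSMul (DihedralGroup 0) X]
    (hfree : ∀ (n : ℤ) (x : X), rot n • x = x → n = 0) {x₀ : X} (hx₀ : refl 0 • x₀ = x₀) (N : ℕ) :
    ∃ Y : Set X, IsClopen Y ∧ x₀ ∈ Y ∧ (∀ x ∈ Y, refl 0 • x ∈ Y) ∧
      ∀ i : ℕ, 0 < i → i < N → ∀ x ∈ Y, rot i • x ∉ Y := by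
  have hV : ∀ i : ℕ, ∃ V : Set X, IsClopen V ∧ x₀ ∈ V ∧ (0 < i → rot i • x₀ ∉ V) := by
    intro i
    rcases Nat.eq_zero_or_pos i with rfl | hi
    · exact ⟨Set.univ, isClopen_univ, Set.mem_univ _, fun h => absurd h (lt_irrefl _)⟩
    · have hne : rot i • x₀ ≠ x₀ := fun h => by
        have := hfree _ _ h
        omega
      obtain ⟨V, hV, hxV, hVs⟩ := compact_exists_isClopen_in_isOpen
        (isOpen_compl_singleton (x := rot (i : ℤ) • x₀)) hne.symm
      exact ⟨V, hV, hxV, fun _ h => hVs h rfl⟩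
  choose V hVc hxV hVi using hV
  have hcont : ∀ g : DihedralGroup 0, Continuous fun x : X => g • x := continuous_const_smul
  set U : Set X := ⋂ i ∈ Finset.Ioo 0 N, (V i ∩ (fun x => rot (i : ℤ) • x) ⁻¹' (V i)ᶜ) with hU
  have hUc : IsClopen U := isClopen_biInter_finset fun i _ =>
    (hVc i).inter ((hVc i).compl.preimage (hcont _))
  have hxU : x₀ ∈ U := Set.mem_iInter₂.2 fun i hi => ⟨hxV i, hVi i (Finset.mem_Ioo.1 hi).1⟩
  refine ⟨U ∩ (fun x => refl 0 • x) ⁻¹' U, hUc.inter (hUc.preimage (hcont _)), ⟨hxU, ?_⟩, ?_, ?_⟩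
  · show refl 0 • x₀ ∈ U
    rwa [hx₀]
  · intro x hx
    refine ⟨hx.2, ?_⟩
    show refl 0 • refl 0 • x ∈ U
    rw [refl_smul_refl_smul, sub_self, rot_zero_smul]
    exact hx.1
  · intro i hi hiN x hx h
    have hi' : i ∈ Finset.Ioo 0 N := Finset.mem_Ioo.2 ⟨hi, hiN⟩
    exact (Set.mem_iInter₂.1 hx.1 i hi').2 (Set.mem_iInter₂.1 h.1 i hi').1

theorem almostFinite_of_metricSpace [MetricSpace X] [CompactSpace X]
    [TotallyDisconnectedSpace X] [ContinuousConstSMul (DihedralGroup 0) X]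
    (hfree : ∀ (n : ℤ) (x : X), rot n • x = x → n = 0)
    (hmin : ∀ U : Set X, IsOpen U → U.Nonempty → ∀ x : X, ∃ n : ℕ, 0 < n ∧ rot n • x ∈ U)
    {x₀ : X} (hx₀ : refl 0 • x₀ = x₀) : AlmostFinite (DihedralGroup 0) X := by
  intro K m hm ε hε
  obtain ⟨N, hN⟩ := exists_isFolner_dihedralBox K hε
  obtain ⟨Y, hY, hxY, hsym, hYN⟩ := exists_isClopen_symm_nhds hfree hx₀ (N + m + 2)
  have hrec := hmin Y hY.isOpen ⟨x₀, hxY⟩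
  have hlarge : ∀ y ∈ Y, N + m + 2 ≤ hitTime Y y := by
    intro y hy
    by_contra hlt
    obtain ⟨hpos, hmem⟩ := hitTime_spec hrec y
    exact hYN _ hpos (by omega) y hy hmem
  obtain ⟨L, hL⟩ := (isCompact_range (continuous_hitTime hY hrec)).bddAbove
  replace hL : ∀ x, hitTime Y x ≤ L := fun x => hL ⟨x, rfl⟩
  obtain ⟨W, hW, hWY, hfix, hWflip, hWd⟩ :=
    exists_isClopen_nhds_flipHit_fixed hY hrec hsym hfree L
  obtain ⟨n, B, k, hBo, hBZ, hBk, hky, hBf, hBd, hdiam, hcov⟩ :=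
    exists_tower_bases hY (hY.diff hW) Set.sdiff_subset hrec hsym
      (fun y hy h => hy.2 (hfix y hy.1 h)) hε
  have hBY : ∀ i, ∀ y ∈ B i, y ∈ Y := fun i y hy => (hBZ i hy).1
  have hk : ∀ i, N + m + 2 ≤ k i := fun i => by
    obtain ⟨y, hy, h⟩ := hky i
    exact h ▸ hlarge y hy
  have hlevel : ∀ i, ∀ s ∈ dihedralBox 0 (k i), ∀ y ∈ B i, ∃ a : ℕ, a < k i ∧
      ((s = rot a ∧ s • y = rot a • y) ∨
        (s = refl (k i - a) ∧ s • y = rot a • flipHit Y y)) := by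
    intro i s hs y hy
    rcases rot_or_refl s with ⟨b, rfl⟩ | ⟨b, rfl⟩
    · rw [rot_mem_dihedralBox] at hs
      lift b to ℕ using hs.1
      exact ⟨b, by omega, Or.inl ⟨rfl, rfl⟩⟩
    · rw [refl_mem_dihedralBox] at hs
      have hb : (k i : ℤ) - ((k i - b.toNat : ℕ) : ℤ) = b := by omega
      refine ⟨k i - b.toNat, by omega, Or.inr ⟨by rw [hb], ?_⟩⟩
      rw [flipHit, rot_smul_refl_smul, hBk i y hy, hb]
  have hkf : ∀ i, ∀ y ∈ B i, hitTime Y (flipHit Y y) = k i := fun i y hy => by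
    rw [hitTime_flipHit hrec hsym (hBY i y hy), hBk i y hy]
  have hcastle : IsCastle (DihedralGroup 0) X (fun i => dihedralBox 0 (k i)) B := by
    intro i j s hs t ht hst
    rw [Set.disjoint_left]
    rintro _ ⟨y, hy, rfl⟩ ⟨z, hz, hzy⟩
    replace hzy : t • z = s • y := hzy
    apply hst
    obtain ⟨a, ha, h1⟩ := hlevel i s hs y hy
    obtain ⟨b, hb, h2⟩ := hlevel j t ht z hz
    have hfy := flipHit_mem hrec hsym y
    have hfz := flipHit_mem hrec hsym z
    rcases h1 with ⟨rfl, h1⟩ | ⟨rfl, h1⟩ <;> rcases h2 with ⟨rfl, h2⟩ | ⟨rfl, h2⟩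
    · obtain ⟨rfl, rfl⟩ := eq_of_rot_smul_eq (hBY i y hy) (hBY j z hz)
        (by rwa [hBk i y hy]) (by rwa [hBk j z hz]) hzy.symm
      rw [hBd i j y hy hz]
    · rw [h2] at hzy
      obtain ⟨rfl, rfl⟩ := eq_of_rot_smul_eq (hBY i y hy) hfz
        (by rwa [hBk i y hy]) (by rwa [hkf j z hz]) hzy.symm
      exact absurd hy (hBf j i z hz)
    · rw [h1] at hzy
      obtain ⟨rfl, rfl⟩ := eq_of_rot_smul_eq (hBY j z hz) hfy
        (by rwa [hBk j z hz]) (by rwa [hkf i y hy]) hzy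
      exact absurd hz (hBf i j y hy)
    · rw [h1, h2] at hzy
      obtain ⟨rfl, hyz⟩ := eq_of_rot_smul_eq hfy hfz
        (by rwa [hkf i y hy]) (by rwa [hkf j z hz]) hzy.symm
      have hyz' : y = z := by
        rw [← flipHit_flipHit hrec hsym (hBY i y hy), hyz,
          flipHit_flipHit hrec hsym (hBY j z hz)]
      subst hyz'
      rw [hBd i j y hy hz]
  have hcover : ∀ y ∈ Y \ W, ∃ i, ∃ z ∈ B i, z ∈ Y ∧ (y = z ∨ y = flipHit Y z) := by
    intro y hy
    obtain ⟨i, h | h⟩ := hcov y hy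
    · exact ⟨i, y, h, hy.1, Or.inl rfl⟩
    · exact ⟨i, _, h, hBY i _ h, Or.inr (flipHit_flipHit hrec hsym hy.1).symm⟩
  refine ⟨n, fun i => dihedralBox 0 (k i), B, hcastle, hBo,
    fun i => hN _ ((by omega : N ≤ N + m + 2).trans (hk i)), hdiam,
    fun i => {rot 0, refl (k i)}, fun i => ⟨?_, ?_⟩, ?_⟩
  · intro g hg
    have hki := hk i
    rcases Finset.mem_insert.1 hg with rfl | hg
    · rw [rot_mem_dihedralBox]
      omega
    · rw [Finset.mem_singleton.1 hg, refl_mem_dihedralBox]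
      omega
  · have hm' : (0 : ℝ) < m := by exact_mod_cast hm
    have h1 : ((({rot 0, refl (k i)} : Finset (DihedralGroup 0)).card : ℕ) : ℝ) ≤ 2 := by
      exact_mod_cast Finset.card_le_two
    have h2 : ((dihedralBox 0 (k i)).card : ℝ) = 2 * k i := by
      rw [card_dihedralBox]
      simp
    have h3 : ((N + m + 2 : ℕ) : ℝ) ≤ k i := by exact_mod_cast hk i
    push_cast at h3
    rw [lt_div_iff₀ hm', h2]
    have : (0 : ℝ) ≤ N := Nat.cast_nonneg N
    nlinarith
  refine subord_of_fintype (ι := Fin L × Fin (L * L + 1))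
    (fun p => rot (p.1 : ℕ) • {y | y ∈ W ∧ iterHitTime Y (p.1 + 1) y = p.2})
    (fun p => rot ((p.2 : ℕ) - (p.1 : ℕ))) ?_ ?_ ?_ ?_
  · intro p
    exact (hW.isOpen.inter ((isOpen_discrete {(p.2 : ℕ)}).preimage
      (continuous_iterHitTime hY hrec _))).smul _
  · rintro x ⟨-, hx⟩
    obtain ⟨a, y, hy, ha, rfl⟩ := exists_eq_rot_smul hrec hsym x
    by_cases hyW : y ∈ W
    · have haL := ha.trans_le (hL y)
      have hle := iterHitTime_le hL (a + 1) y
      have hle' : (a + 1) * L ≤ L * L := Nat.mul_le_mul_right L haL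
      exact Set.mem_iUnion.2 ⟨(⟨a, haL⟩, ⟨iterHitTime Y (a + 1) y, by omega⟩),
        ⟨y, ⟨hyW, rfl⟩, rfl⟩⟩
    · exfalso
      apply hx
      obtain ⟨i, z, hz, hzY, rfl | rfl⟩ := hcover y ⟨hy, hyW⟩
      · refine Set.mem_iUnion.2 ⟨i, Set.mem_iUnion₂.2 ⟨rot a, ?_, ⟨y, hz, rfl⟩⟩⟩
        rw [hBk i y hz] at ha
        rw [rot_mem_dihedralBox]
        omega
      · refine Set.mem_iUnion.2 ⟨i, Set.mem_iUnion₂.2 ⟨refl (k i - a), ?_, ⟨z, hz, ?_⟩⟩⟩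
        · rw [hkf i z hz] at ha
          rw [refl_mem_dihedralBox]
          omega
        · show refl (k i - a) • z = rot a • flipHit Y z
          rw [flipHit, rot_smul_refl_smul, hBk i z hz]
  all_goals
    have himg : ∀ p : Fin L × Fin (L * L + 1),
        ∀ x ∈ (rot ((p.2 : ℕ) - (p.1 : ℕ)) • rot (p.1 : ℕ) •
          {y | y ∈ W ∧ iterHitTime Y (p.1 + 1) y = p.2} : Set X),
        ∃ y ∈ W, iterHitTime Y (p.1 + 1) y = p.2 ∧ x = (firstHit Y)^[p.1 + 1] y := by
      rintro p _ ⟨_, ⟨y, ⟨hy, hn⟩, rfl⟩, rfl⟩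
      refine ⟨y, hy, hn, ?_⟩
      rw [iterate_firstHit, hn]
      show rot _ • rot _ • y = _
      rw [rot_smul_rot_smul, sub_add_cancel]
  · intro p x hx
    obtain ⟨y, hy, -, rfl⟩ := himg p x hx
    obtain ⟨i, z, hz, hzY, h | h⟩ := hcover _
      ⟨(firstHit_mapsTo hrec).iterate _ (hWY hy), hWd _ (Nat.succ_pos _) p.1.2 y hy⟩
    · refine Set.mem_iUnion.2 ⟨i, Set.mem_iUnion₂.2 ⟨rot 0, by simp, ⟨z, hz, ?_⟩⟩⟩
      rw [h]
      exact rot_zero_smul z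
    · refine Set.mem_iUnion.2 ⟨i, Set.mem_iUnion₂.2 ⟨refl (k i), by simp, ⟨z, hz, ?_⟩⟩⟩
      rw [h, flipHit, hBk i z hz]
  · intro p q hpq
    refine Set.disjoint_left.2 fun x hx hx' => ?_
    obtain ⟨y, hy, hyn, rfl⟩ := himg p x hx
    obtain ⟨z, hz, hzn, h⟩ := himg q _ hx'
    obtain ⟨h1, rfl⟩ := eq_of_iterate_firstHit_eq hrec hWY hWd hy hz p.1.2 q.1.2 h
    apply hpq
    have h2 : p.1 = q.1 := Fin.ext (by omega)
    refine Prod.ext h2 (Fin.ext ?_)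
    rw [← hyn, ← hzn, h2]

theorem almostFinite_of_eq_topology [t : TopologicalSpace X] [CompactSpace X]
    [TotallyDisconnectedSpace X] [ContinuousConstSMul (DihedralGroup 0) X]
    (hfree : ∀ (n : ℤ) (x : X), rot n • x = x → n = 0)
    (hmin : ∀ U : Set X, IsOpen U → U.Nonempty → ∀ x : X, ∃ n : ℕ, 0 < n ∧ rot n • x ∈ U)
    {x₀ : X} (hx₀ : refl 0 • x₀ = x₀) (m : MetricSpace X)
    (hm : m.toUniformSpace.toTopologicalSpace = t) :
    @AlmostFinite (DihedralGroup 0) X _ m _ := by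
  subst hm
  exact almostFinite_of_metricSpace hfree hmin hx₀

end AlmostFinite

section Recurrent

variable {X : Type*} [MulAction (DihedralGroup 0) X] [TopologicalSpace X]

lemma minimal_of_recurrent
    (hmin : ∀ U : Set X, IsOpen U → U.Nonempty → ∀ x : X, ∃ n : ℕ, 0 < n ∧ rot n • x ∈ U) :
    Minimal (DihedralGroup 0) X := by
  intro x
  refine dense_iff_inter_open.2 fun U hU hne => ?_
  obtain ⟨n, -, hn⟩ := hmin U hU hne x
  exact ⟨_, hn, MulAction.mem_orbit x _⟩

lemma rot_smul_ne_of_recurrent [T1Space X] [Infinite X]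
    (hmin : ∀ U : Set X, IsOpen U → U.Nonempty → ∀ x : X, ∃ n : ℕ, 0 < n ∧ rot n • x ∈ U)
    (n : ℤ) (x : X) (hx : rot n • x = x) : n = 0 := by
  by_contra hn
  have hper : Function.Periodic (fun i : ℤ => rot i • x) n := fun i => by
    show rot (i + n) • x = rot i • x
    rw [← rot_smul_rot_smul, hx]
  have hper' : Function.Periodic (fun i : ℤ => rot i • x) |n| := by
    rcases abs_choice n with h | h
    · rwa [h]
    · rw [h]
      exact hper.neg
  have hfin : (Set.range fun i : ℤ => rot i • x).Finite := by
    rw [← hper'.image_Ioc (abs_pos.2 hn) 0]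
    exact (Set.finite_Ioc _ _).image _
  obtain ⟨m, -, hm⟩ := hmin _ hfin.isClosed.isOpen_compl hfin.infinite_compl.nonempty x
  exact hm ⟨m, rfl⟩

lemma topFree_of_recurrent [T2Space X] [ContinuousConstSMul (DihedralGroup 0) X]
    (hfree : ∀ (n : ℤ) (x : X), rot n • x = x → n = 0)
    (hmin : ∀ U : Set X, IsOpen U → U.Nonempty → ∀ x : X, ∃ n : ℕ, 0 < n ∧ rot n • x ∈ U) :
    TopFree (DihedralGroup 0) X := by
  intro g hg
  have hcl : IsClosed {x : X | g • x = x} := isClosed_eq (continuous_const_smul g) continuous_id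
  rw [hcl.closure_eq]
  by_contra hne
  obtain ⟨x, hxU⟩ := Set.nonempty_iff_ne_empty.2 hne
  have hx : g • x = x := interior_subset (s := {y : X | g • y = y}) hxU
  rcases rot_or_refl g with ⟨n, rfl⟩ | ⟨n, rfl⟩
  · exact hg (by rw [hfree n x hx, rot_zero])
  · obtain ⟨m, hm, hmU⟩ := hmin _ isOpen_interior ⟨x, hxU⟩ x
    have h1 : refl n • rot m • x = rot m • x :=
      interior_subset (s := {y : X | refl n • y = y}) hmU
    have h2 : rot (-2 * m) • x = x := by
      have h3 : refl (n + m) • x = refl (n - m) • x := by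
        rw [← refl_smul_rot_smul, h1, ← rot_smul_refl_smul, hx]
      have h4 := congrArg (fun y => refl (n + m) • y) h3
      simp only [refl_smul_refl_smul, sub_self, rot_zero_smul] at h4
      conv_rhs => rw [h4]
      congr 2
      ring
    have := hfree _ _ h2
    omega

end Recurrent

section Subshift

instance continuousConstSMul_shift (Γ A : Type*) [Group Γ] [TopologicalSpace A] :
    ContinuousConstSMul Γ (Γ → A) where
  continuous_const_smul g := continuous_pi fun h => continuous_apply (g⁻¹ * h)

instance continuousConstSMul_orbitClosure (Γ : Type*) [Group Γ] {A : Type*} [TopologicalSpace A]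
    (x : Γ → A) : ContinuousConstSMul Γ (OrbitClosure Γ x) where
  continuous_const_smul g :=
    ((continuous_const_smul g).comp continuous_subtype_val).subtype_mk _

instance compactSpace_orbitClosure (Γ : Type*) [Group Γ] {A : Type*} [TopologicalSpace A]
    [CompactSpace A] (x : Γ → A) : CompactSpace (OrbitClosure Γ x) :=
  isCompact_iff_compactSpace.1 (IsClosed.isCompact isClosed_closure)

variable {A : Type*} (w : ℤ → A)

lemma refl_zero_smul_amplify : refl 0 • amplify w = amplify w := by
  funext g
  rcases rot_or_refl g with ⟨i, rfl⟩ | ⟨i, rfl⟩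
  · show amplify w ((refl 0)⁻¹ * rot i) = w i
    rw [refl_inv, refl_mul_rot, zero_add]
    rfl
  · show amplify w ((refl 0)⁻¹ * refl i) = w i
    rw [refl_inv, refl_mul_refl, sub_zero]
    rfl

lemma exists_smul_amplify_eq (g : DihedralGroup 0) :
    ∃ a : ℤ, g • amplify w = rot a • amplify w := by
  rcases rot_or_refl g with ⟨i, rfl⟩ | ⟨i, rfl⟩
  · exact ⟨i, rfl⟩
  · refine ⟨-i, ?_⟩
    conv_rhs => rw [← refl_zero_smul_amplify, rot_smul_refl_smul]
    simp

/-- The element of `A^{D∞}` given by one word on the rotations and one on the reflections. -/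
def glue (p : (ℤ → A) × (ℤ → A)) : DihedralGroup 0 → A
  | DihedralGroup.r i => p.1 i
  | DihedralGroup.sr i => p.2 i

lemma rot_smul_amplify (n : ℤ) :
    rot n • amplify w = glue (zShift n w, zShift (-n) w) := by
  funext g
  rcases rot_or_refl g with ⟨i, rfl⟩ | ⟨i, rfl⟩
  · show amplify w ((rot n)⁻¹ * rot i) = w (i - n)
    rw [rot_inv, rot_mul_rot, neg_add_eq_sub]
    rfl
  · show amplify w ((rot n)⁻¹ * refl i) = w (i - -n)
    rw [rot_inv, rot_mul_refl]
    rfl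

variable [TopologicalSpace A]

lemma continuous_glue : Continuous (glue (A := A)) := by
  refine continuous_pi fun g => ?_
  cases g with
  | r i => exact (continuous_apply (A := fun _ : ℤ => A) i).comp continuous_fst
  | sr i => exact (continuous_apply (A := fun _ : ℤ => A) i).comp continuous_snd

variable {w}

lemma zSyndetic_rot_smul_amplify (hbal : zBalanced w) {U : Set (DihedralGroup 0 → A)}
    (hU : U ∈ nhds (amplify w)) : zSyndetic {n : ℤ | rot n • amplify w ∈ U} := by
  have hw : glue (w, w) = amplify w := by
    funext g
    cases g <;> rfl
  have hpre : glue ⁻¹' U ∈ nhds (w, w) := by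
    refine continuous_glue.continuousAt ?_
    rwa [hw]
  rw [nhds_prod_eq, Filter.mem_prod_same_iff] at hpre
  obtain ⟨V, hV, hVU⟩ := hpre
  obtain ⟨P, ⟨K, hK⟩, hPV, hsymm⟩ := hbal V hV
  refine ⟨K, fun n => ?_⟩
  obtain ⟨k, hk, hn⟩ := hK n
  refine ⟨k, hk, ?_⟩
  show rot (n - k) • amplify w ∈ U
  rw [rot_smul_amplify]
  exact hVU ⟨hPV hn, hPV ((hsymm _).1 hn)⟩

lemma exists_pos_rot_smul_mem [RegularSpace A] (hbal : zBalanced w)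
    (U : Set (OrbitClosure (DihedralGroup 0) (amplify w))) (hU : IsOpen U) (hne : U.Nonempty)
    (x : OrbitClosure (DihedralGroup 0) (amplify w)) : ∃ n : ℕ, 0 < n ∧ rot n • x ∈ U := by
  obtain ⟨O, hO, rfl⟩ := isOpen_induced_iff.1 hU
  obtain ⟨y, hy⟩ := hne
  obtain ⟨_, hgO, g, rfl⟩ := mem_closure_iff.1 y.2 O hO hy
  obtain ⟨a, ha⟩ := exists_smul_amplify_eq w g
  have hgO' : rot a • amplify w ∈ O := ha ▸ hgO
  have hnhds : (fun z => rot a • z) ⁻¹' O ∈ nhds (amplify w) :=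
    (hO.preimage (continuous_const_smul (rot a))).mem_nhds hgO'
  obtain ⟨C, hC, hCc, hCO⟩ := exists_mem_nhds_isClosed_subset hnhds
  obtain ⟨K, hK⟩ := zSyndetic_rot_smul_amplify hbal hC
  set E : Set (DihedralGroup 0 → A) := ⋃ k ∈ K, (fun z => rot (-k) • z) ⁻¹' C
  have hE : IsClosed E :=
    isClosed_biUnion_finset fun k _ => hCc.preimage (continuous_const_smul (rot (-k)))
  have horb : MulAction.orbit (DihedralGroup 0) (amplify w) ⊆ E := by
    rintro _ ⟨g, rfl⟩
    obtain ⟨n, hn⟩ := exists_smul_amplify_eq w g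
    obtain ⟨k, hk, hkC⟩ := hK n
    refine Set.mem_iUnion₂.2 ⟨k, hk, ?_⟩
    show rot (-k) • g • amplify w ∈ C
    rw [hn, rot_smul_rot_smul, neg_add_eq_sub]
    exact hkC
  set n₀ : ℕ := a.natAbs + K.sup Int.natAbs + 1
  obtain ⟨k, hk, hkC⟩ := Set.mem_iUnion₂.1 (closure_minimal horb hE (rot n₀ • x).2)
  have hk' : k.natAbs ≤ K.sup Int.natAbs := Finset.le_sup hk
  have hpos : 0 < a + (-k + n₀) := by omega
  refine ⟨(a + (-k + n₀)).toNat, by omega, ?_⟩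
  rw [Int.toNat_of_nonneg hpos.le, ← rot_smul_rot_smul, ← rot_smul_rot_smul]
  exact hCO hkC

end Subshift

end Paper

open Paper

theorem amplified_subshift_minimal_topFree_notFree_almostFinite
    (A : Type*) [TopologicalSpace A] [DiscreteTopology A] [Finite A]
    (w : ℤ → A) (hap : zAP w) (hbal : zBalanced w)
    (hinf : (OrbitClosure (DihedralGroup 0) (amplify w)).Infinite) :
    Minimal (DihedralGroup 0) (OrbitClosure (DihedralGroup 0) (amplify w)) ∧
    TopFree (DihedralGroup 0) (OrbitClosure (DihedralGroup 0) (amplify w)) ∧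
    ¬ (∀ (g : DihedralGroup 0) (y : OrbitClosure (DihedralGroup 0) (amplify w)),
        g • y = y → g = 1) ∧
    (∀ m : MetricSpace (OrbitClosure (DihedralGroup 0) (amplify w)),
      m.toUniformSpace.toTopologicalSpace =
        (inferInstance : TopologicalSpace (OrbitClosure (DihedralGroup 0) (amplify w))) →
      @AlmostFinite (DihedralGroup 0) (OrbitClosure (DihedralGroup 0) (amplify w)) _ m _) := by
  have hmin := exists_pos_rot_smul_mem hbal
  have := hinf.to_subtype
  have hfree := rot_smul_ne_of_recurrent hmin
  let x₀ : OrbitClosure (DihedralGroup 0) (amplify w) :=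
    ⟨amplify w, subset_closure (MulAction.mem_orbit_self _)⟩
  have hx₀ : refl 0 • x₀ = x₀ := Subtype.ext (refl_zero_smul_amplify w)
  refine ⟨minimal_of_recurrent hmin, topFree_of_recurrent hfree hmin, fun h => ?_,
    fun m hm => almostFinite_of_eq_topology hfree hmin hx₀ m hm⟩
  exact rot_ne_refl 0 0 (h (refl 0) x₀ hx₀).symm
end

section
/- Let F be a finite group. Every minimal topologically free continuous action of ℤ × F on an infinite compact Hausdorff space X is free. -/
open scoped Pointwise
open MeasureTheory

open Paper

/-- In a minimal topologically free action on a compact Hausdorff space, an element with finite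
conjugacy class that fixes a point is trivial. -/
theorem eq_one_of_smul_eq_of_finite_conjugatesOf {G X : Type*} [Group G] [TopologicalSpace X]
    [CompactSpace X] [T2Space X] [MulAction G X] [ContinuousConstSMul G X]
    (hmin : Minimal G X) (htf : TopFree G X) {g : G} (hg : (conjugatesOf g).Finite)
    {x : X} (hx : g • x = x) : g = 1 := by
  by_contra hne
  have : Finite (conjugatesOf g) := hg
  have : Nonempty X := ⟨x⟩
  have hclosed : ∀ c : conjugatesOf g, IsClosed {y : X | (c : G) • y = y} := fun c =>
    isClosed_eq (continuous_const_smul _) continuous_id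
  have horbit : MulAction.orbit G x ⊆ ⋃ c : conjugatesOf g, {y : X | (c : G) • y = y} := by
    rintro _ ⟨h, rfl⟩
    refine Set.mem_iUnion.2 ⟨⟨h * g * h⁻¹, isConj_iff.2 ⟨h, rfl⟩⟩, ?_⟩
    simp [mul_smul, hx]
  have hcover : (⋃ c : conjugatesOf g, {y : X | (c : G) • y = y}) = Set.univ :=
    Set.univ_subset_iff.1 <| (hmin x).closure_eq.symm.subset.trans <|
      closure_minimal horbit (isClosed_iUnion_of_finite hclosed)
  obtain ⟨⟨c, hc⟩, hint⟩ := nonempty_interior_of_iUnion_of_closed hclosed hcover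
  have hc_ne : c ≠ 1 := by
    rintro rfl
    exact hne (isConj_one_left.1 hc)
  have hempty := htf c hc_ne
  rw [(hclosed ⟨c, hc⟩).closure_eq] at hempty
  exact hint.ne_empty hempty

theorem finite_conjugatesOf_commGroup_prod_finite {A F : Type*} [CommGroup A] [Group F] [Finite F]
    (g : A × F) : (conjugatesOf g).Finite := by
  refine (Set.finite_range fun k : F => (g.1, k)).subset ?_
  intro c hc
  obtain ⟨h, rfl⟩ := isConj_iff.1 hc
  exact ⟨h.2 * g.2 * h.2⁻¹, by ext <;> simp⟩

theorem free_of_minimal_topFree_int_prod_finite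
    (F : Type*) [Group F] [Finite F]
    (X : Type*) [TopologicalSpace X] [CompactSpace X] [T2Space X] [Infinite X]
    [MulAction (Multiplicative ℤ × F) X] [ContinuousConstSMul (Multiplicative ℤ × F) X]
    (hmin : Minimal (Multiplicative ℤ × F) X)
    (htf : TopFree (Multiplicative ℤ × F) X) :
    ∀ (g : Multiplicative ℤ × F) (x : X), g • x = x → g = 1 := by
  intro g x hx
  exact eq_one_of_smul_eq_of_finite_conjugatesOf hmin htf
    (finite_conjugatesOf_commGroup_prod_finite g) hx
end

section
/- Let F be a finite group and Γ = D∞ × F. Let w ∈ {0,1}^{D∞} be almost periodic for the left shift action of D∞. Let A = {0} ∪ {a_s : s ∈ F} be an alphabet of |F| + 1 pairwise distinct symbols; for each s ∈ F let w_s ∈ A^{D∞} be obtained from w by replacing every symbol 1 by a_s (i.e. w_s(g) = a_s if w(g) = 1 and w_s(g) = 0 otherwise), and define x₀ ∈ A^Γ by x₀(g, s) = w_s(g) for g ∈ D∞, s ∈ F. Then x₀ is almost periodic for the left shift action of Γ on A^Γ. -/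
namespace Paper

/-- The word `x₀ ∈ A^(D∞ × F)` from the paper: `x₀(g, s) = w_s(g)`, where `w_s` is obtained
from the `{0,1}`-word `w` by replacing every symbol `1` by `a_s` and `0` by `z`. -/
def x0word {F A : Type*} (a : F → A) (z : A) (w : DihedralGroup 0 → Bool) :
    (DihedralGroup 0 × F) → A :=
  fun p => if w p.1 then a p.2 else z

end Paper

open Paper

theorem continuous_x0word {F A : Type*} [TopologicalSpace A] (a : F → A) (z : A) :
    Continuous (x0word a z) :=
  continuous_pi fun p =>
    (continuous_of_discreteTopology (f := fun b : Bool => if b then a p.2 else z)).comp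
      (continuous_apply p.1)

theorem x0word_smul {F A : Type*} [Group F] (a : F → A) (z : A)
    (g : DihedralGroup 0) (w : DihedralGroup 0 → Bool) :
    x0word a z (g • w) = (g, (1 : F)) • x0word a z w := by
  funext p
  change (if w (g⁻¹ * p.1) then a p.2 else z) =
    if w (g⁻¹ * p.1) then a ((1 : F)⁻¹ * p.2) else z
  rw [inv_one, one_mul]

theorem x0_almostPeriodic
    (F : Type*) [Group F] [Fintype F]
    (A : Type*) [TopologicalSpace A] [DiscreteTopology A]
    (a : F → A) (z : A) (hinj : Function.Injective a) (hz : ∀ s : F, a s ≠ z)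
    (hA : ∀ b : A, b = z ∨ ∃ s : F, b = a s)
    (w : DihedralGroup 0 → Bool) (hw : APoint w) :
    APoint (x0word a z w) := by
  intro U hU
  obtain ⟨K, hK⟩ := hw _ ((continuous_x0word a z).continuousAt.preimage_mem_nhds hU)
  refine ⟨K ×ˢ Finset.univ, fun ⟨g, s⟩ => ?_⟩
  obtain ⟨k, hk, hkU⟩ := hK g
  refine ⟨(k, s), Finset.mk_mem_product hk (Finset.mem_univ s), ?_⟩
  have h : x0word a z ((k⁻¹ * g) • w) ∈ U := hkU
  rw [x0word_smul] at h
  have hks : (k, s)⁻¹ * (g, s) = (k⁻¹ * g, (1 : F)) :=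
    Prod.ext rfl (inv_mul_cancel s)
  rw [hks]
  exact h
end
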